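/- Let t be a positive integer, let n be a nonnegative integer, and let a₁, …, a_t be nonnegative integers. The number of partitions λ with λ_1 + λ_{t+1} + λ_{2t+1} + ⋯ = n and, for each 1 ≤ i ≤ t, ∑_{k≥0} (λ_{kt+i} − λ_{kt+i+1}) = a_i, equals the number of t-tuples (μ^(1), …, μ^(t)) of partitions with ℓ(μ^(i)) = a_i for each i and |μ^(1)| + ⋯ + |μ^(t)| = n. (This is the coefficient-wise form of the multivariable identity ∑_{λ∈𝒫} ∏_{i=1}^{t} z_i^{c_i(λ)} q^{λ_1+λ_{t+1}+λ_{2t+1}+⋯} = ∏_{i=1}^{t} 1/(qz_i;q)_∞.) -/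

import Mathlib

/-- A partition: a weakly decreasing sequence of naturals with finite support.
`p.parts i` is the `(i+1)`-st part, i.e. parts are 0-indexed (`λ_1 = p.parts 0`). -/
structure Ptn where
  parts : ℕ → ℕ
  antitone' : ∀ ⦃i j : ℕ⦄, i ≤ j → parts j ≤ parts i
  finite_support' : (Function.support parts).Finite

namespace Ptn

/-- The size `|λ|` of a partition: the sum of all its parts. -/
noncomputable def size (p : Ptn) : ℕ := ∑ᶠ i, p.parts i

/-- The number of (nonzero) parts `ℓ(λ)`. -/
noncomputable def length (p : Ptn) : ℕ := (Function.support p.parts).ncard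

/-- A partition has distinct parts if no nonzero value is repeated. -/
def Distinct (p : Ptn) : Prop := ∀ i : ℕ, p.parts (i + 1) ≠ 0 → p.parts (i + 1) < p.parts i

/-- A partition has odd parts if every part is odd. -/
def OddParts (p : Ptn) : Prop := ∀ i : ℕ, p.parts i ≠ 0 → Odd (p.parts i)

end Ptn

namespace Ptn

@[ext]
theorem ext {p q : Ptn} (h : ∀ i, p.parts i = q.parts i) : p = q := by
  cases p; cases q
  simpa using funext h

theorem exists_parts_eq_zero (p : Ptn) : ∃ N, ∀ i, N ≤ i → p.parts i = 0 := by
  obtain ⟨N, hN⟩ := p.finite_support'.bddAbove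
  refine ⟨N + 1, fun i hi => ?_⟩
  by_contra h
  have := hN (Function.mem_support.2 h)
  omega

/-- A weakly decreasing sequence that vanishes from `N` on. -/
def ofEventuallyZero (f : ℕ → ℕ) (hf : Antitone f) (N : ℕ) (hN : f N = 0) : Ptn where
  parts := f
  antitone' := hf
  finite_support' := (Set.finite_Iio N).subset fun i hi => by
    by_contra h
    have := hf (not_lt.1 h)
    exact hi (by omega)

theorem finsum_parts_mul (p : Ptn) {t N : ℕ} (ht : 1 ≤ t) (hN : ∀ i, N ≤ i → p.parts i = 0) :
    ∑ᶠ m, p.parts (m * t) = ∑ m ∈ Finset.range N, p.parts (m * t) := by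
  refine finsum_eq_sum_of_support_subset _ fun m hm => ?_
  by_contra h
  exact hm (hN _ ((by simpa using h : N ≤ m).trans (Nat.le_mul_of_pos_right m ht)))

theorem size_eq_sum_range (p : Ptn) {N : ℕ} (hN : ∀ i, N ≤ i → p.parts i = 0) :
    p.size = ∑ i ∈ Finset.range N, p.parts i := by
  simpa [size] using p.finsum_parts_mul le_rfl hN

section Conj

theorem exists_parts_le (p : Ptn) (i : ℕ) : ∃ j, p.parts j ≤ i := by
  obtain ⟨N, hN⟩ := p.exists_parts_eq_zero
  exact ⟨N, by simp [hN N le_rfl]⟩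

theorem lt_find_parts_le_iff (p : Ptn) (i j : ℕ) :
    j < Nat.find (p.exists_parts_le i) ↔ i < p.parts j := by
  rw [Nat.lt_find_iff]
  exact ⟨fun h => not_le.1 (h j le_rfl), fun h m hm => not_le.2 (h.trans_le (p.antitone' hm))⟩

/-- The conjugate partition. -/
def conj (p : Ptn) : Ptn :=
  ofEventuallyZero (fun i => Nat.find (p.exists_parts_le i))
    (fun i j hij => Nat.find_mono fun _ h => h.trans hij) (p.parts 0) (by simp)

theorem lt_conj_parts_iff (p : Ptn) (i j : ℕ) : j < p.conj.parts i ↔ i < p.parts j :=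
  p.lt_find_parts_le_iff i j

theorem conj_conj (p : Ptn) : p.conj.conj = p := by
  ext i
  refine eq_of_forall_lt_iff fun j => ?_
  rw [lt_conj_parts_iff, lt_conj_parts_iff]

theorem conj_length (p : Ptn) : p.conj.length = p.parts 0 := by
  have : Function.support p.conj.parts = Set.Iio (p.parts 0) := by
    ext i
    rw [Function.mem_support, ← Nat.pos_iff_ne_zero, lt_conj_parts_iff, Set.mem_Iio]
  rw [length, this, Set.ncard_eq_toFinset_card']
  simp

theorem conj_size (p : Ptn) : p.conj.size = p.size := by
  obtain ⟨N, hN⟩ := p.exists_parts_eq_zero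
  obtain ⟨M, hM⟩ := p.conj.exists_parts_eq_zero
  have sum_ite : ∀ a b, a ≤ b → ∑ i ∈ Finset.range b, (if i < a then 1 else 0) = a := by
    intro a b hab
    rw [← Finset.sum_filter, Finset.sum_const, smul_eq_mul, mul_one]
    have : {i ∈ Finset.range b | i < a} = Finset.range a := by
      ext i
      simp only [Finset.mem_filter, Finset.mem_range]
      omega
    rw [this, Finset.card_range]
  rw [size_eq_sum_range _ hN, size_eq_sum_range _ hM]
  have hN' : ∀ i, p.conj.parts i ≤ N := fun i => by
    by_contra h
    rw [not_le, lt_conj_parts_iff, hN N le_rfl] at h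
    omega
  have hM' : ∀ i, p.parts i ≤ M := fun i => by
    by_contra h
    rw [not_le, ← lt_conj_parts_iff, hM M le_rfl] at h
    omega
  calc _ = ∑ i ∈ Finset.range M, ∑ j ∈ Finset.range N, (if j < p.conj.parts i then 1 else 0) :=
        Finset.sum_congr rfl fun i _ => (sum_ite _ _ (hN' i)).symm
    _ = ∑ j ∈ Finset.range N, ∑ i ∈ Finset.range M, (if i < p.parts j then 1 else 0) := by
        rw [Finset.sum_comm]
        simp only [lt_conj_parts_iff]
    _ = _ := Finset.sum_congr rfl fun j _ => sum_ite _ _ (hM' j)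

/-- Conjugation as an equivalence. -/
def conjEquiv : Ptn ≃ Ptn := ⟨conj, conj, conj_conj, conj_conj⟩

end Conj

section Diff

/-- The consecutive differences `λ_j - λ_{j+1}` of a partition. -/
noncomputable def diff (p : Ptn) : ℕ →₀ ℕ :=
  Finsupp.ofSupportFinite (fun j => p.parts j - p.parts (j + 1))
    (p.finite_support'.subset fun j hj => by
      simp only [Function.mem_support] at hj ⊢
      omega)

theorem diff_apply (p : Ptn) (j : ℕ) : p.diff j = p.parts j - p.parts (j + 1) := rfl

theorem parts_eq_sum_diff (p : Ptn) (i : ℕ) :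
    p.parts i = p.diff.sum fun j c => if i ≤ j then c else 0 := by
  obtain ⟨N, hN⟩ := p.exists_parts_eq_zero
  have key : ∀ n, p.parts i =
      ∑ j ∈ Finset.range n, (if i ≤ j then p.diff j else 0) + p.parts (max i n) := by
    intro n
    induction n with
    | zero => simp
    | succ n ih =>
      rw [Finset.sum_range_succ, ih]
      have := p.antitone' (Nat.le_succ n)
      split_ifs with h
      · rw [max_eq_right h, max_eq_right (by omega), diff_apply]
        simp only [Nat.succ_eq_add_one] at this
        omega
      · rw [max_eq_left (by omega), max_eq_left (by omega), add_zero]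
  rw [key N, hN _ (le_max_right _ _), add_zero, Finsupp.sum_of_support_subset _ _ _ (by simp)]
  intro j hj
  rw [Finset.mem_range]
  by_contra h
  rw [Finsupp.mem_support_iff, diff_apply, hN j (by omega)] at hj
  omega

/-- The partition with prescribed consecutive differences. -/
noncomputable def ofDiff (f : ℕ →₀ ℕ) : Ptn :=
  ofEventuallyZero (fun i => f.sum fun j c => if i ≤ j then c else 0)
    (fun i i' h => Finset.sum_le_sum fun j _ => by
      dsimp only
      split_ifs <;> omega)
    (f.support.sup id + 1) (Finset.sum_eq_zero fun j hj => by
      have := Finset.le_sup (f := id) hj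
      simp only [id] at this
      exact if_neg (by omega))

theorem diff_ofDiff (f : ℕ →₀ ℕ) : (ofDiff f).diff = f := by
  ext i
  have h : (ofDiff f).parts i = (ofDiff f).parts (i + 1) + f i := by
    have hi : f i = f.sum fun j c => if i = j then c else 0 := by simp [Finsupp.sum_ite_eq]
    rw [hi]
    change (f.sum fun j c => if i ≤ j then c else 0) =
      (f.sum fun j c => if i + 1 ≤ j then c else 0) + _
    rw [← Finsupp.sum_add]
    refine Finset.sum_congr rfl fun j _ => ?_
    dsimp only
    split_ifs <;> omega
  rw [diff_apply, h, Nat.add_sub_cancel_left]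

/-- Partitions correspond to finitely supported sequences of consecutive differences. -/
noncomputable def diffEquiv : Ptn ≃ (ℕ →₀ ℕ) where
  toFun := diff
  invFun := ofDiff
  left_inv p := by
    ext i
    exact (p.parts_eq_sum_diff i).symm
  right_inv := diff_ofDiff

theorem finsum_parts_mul_eq_sum_diff (p : Ptn) {t : ℕ} (ht : 1 ≤ t) :
    ∑ᶠ m, p.parts (m * t) = p.diff.sum fun j c => (j / t + 1) * c := by
  obtain ⟨N, hN⟩ := p.exists_parts_eq_zero
  rw [p.finsum_parts_mul ht hN]
  simp only [p.parts_eq_sum_diff, Finsupp.sum]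
  rw [Finset.sum_comm]
  refine Finset.sum_congr rfl fun j hj => ?_
  have hjN : j < N := by
    by_contra h
    rw [Finsupp.mem_support_iff, diff_apply, hN j (by omega)] at hj
    omega
  rw [← Finset.sum_filter, Finset.sum_const, smul_eq_mul]
  have : {m ∈ Finset.range N | m * t ≤ j} = Finset.range (j / t + 1) := by
    ext m
    have := Nat.div_le_self j t
    rw [Finset.mem_filter, Finset.mem_range, Finset.mem_range, ← Nat.le_div_iff_mul_le ht]
    omega
  rw [this, Finset.card_range]

theorem size_eq_sum_diff (p : Ptn) : p.size = p.diff.sum fun j c => (j + 1) * c := by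
  simpa [size] using p.finsum_parts_mul_eq_sum_diff le_rfl

theorem parts_zero_eq_sum_diff (p : Ptn) : p.parts 0 = p.diff.sum fun _ c => c := by
  simpa using p.parts_eq_sum_diff 0

end Diff

/-- Splitting a finitely supported sequence into its residue classes modulo `t`. -/
noncomputable def residueEquiv (t : ℕ) [NeZero t] : (ℕ →₀ ℕ) ≃ (Fin t → ℕ →₀ ℕ) :=
  (Finsupp.domCongr ((Nat.divModEquiv t).trans (Equiv.prodComm _ _))).toEquiv.trans
    (Finsupp.curryEquiv.trans Finsupp.equivFunOnFinite)

theorem residueEquiv_apply (t : ℕ) [NeZero t] (f : ℕ →₀ ℕ) (i : Fin t) (k : ℕ) :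
    residueEquiv t f i k = f (k * t + i) := by
  simp [residueEquiv, Finsupp.curryEquiv]

theorem sum_residueEquiv (t : ℕ) [NeZero t] (f : ℕ →₀ ℕ) (g : ℕ → ℕ → ℕ) :
    ∑ i, (residueEquiv t f i).sum g = f.sum fun j c => g (j / t) c := by
  let e : ℕ ≃ Fin t × ℕ := (Nat.divModEquiv t).trans (Equiv.prodComm _ _)
  calc _ = (Finsupp.equivMapDomain e f).curry.sum fun _ (h : ℕ →₀ ℕ) => h.sum g :=
        (Finsupp.sum_fintype _ (fun _ (h : ℕ →₀ ℕ) => h.sum g)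
          fun _ => Finsupp.sum_zero_index).symm
    _ = _ := by
        rw [Finsupp.sum_curry_index _ (fun _ => g), Finsupp.sum_equivMapDomain]
        rfl

/-- Conjugates of the partitions whose differences are the residue classes modulo `t` of the
differences of a given partition. -/
noncomputable def colorEquiv (t : ℕ) [NeZero t] : Ptn ≃ (Fin t → Ptn) :=
  (diffEquiv.trans (residueEquiv t)).trans
    (Equiv.piCongrRight fun _ => diffEquiv.symm.trans conjEquiv)

theorem colorEquiv_apply (t : ℕ) [NeZero t] (p : Ptn) (i : Fin t) :
    colorEquiv t p i = (ofDiff (residueEquiv t p.diff i)).conj := rfl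

theorem colorEquiv_length (t : ℕ) [NeZero t] (p : Ptn) (i : Fin t) :
    (colorEquiv t p i).length =
      ∑ᶠ k : ℕ, (p.parts (k * t + (i : ℕ)) - p.parts (k * t + (i : ℕ) + 1)) := by
  rw [colorEquiv_apply, conj_length, parts_zero_eq_sum_diff, diff_ofDiff]
  simp only [← diff_apply, ← residueEquiv_apply]
  exact (finsum_eq_sum_of_support_subset _ (by simp)).symm

theorem sum_colorEquiv_size (t : ℕ) [NeZero t] (p : Ptn) :
    ∑ i, (colorEquiv t p i).size = ∑ᶠ m, p.parts (m * t) := by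
  simp only [colorEquiv_apply, conj_size]
  simp only [size_eq_sum_diff, diff_ofDiff]
  rw [sum_residueEquiv t p.diff (fun k c => (k + 1) * c),
    p.finsum_parts_mul_eq_sum_diff NeZero.one_le]

end Ptn

/-- Coefficient-wise form of the multivariable identity
`∑_{λ∈𝒫} ∏_i z_i^{c_i(λ)} q^{λ_1+λ_{t+1}+λ_{2t+1}+⋯} = ∏_i 1/(qz_i;q)_∞`, where
`c_i(λ) = ∑_{k≥0} (λ_{kt+i} - λ_{kt+i+1})`. Here `i : Fin t` encodes the color `i + 1`. -/
theorem color_conjugate_identity_two (t : ℕ) (ht : 1 ≤ t) (n : ℕ) (a : Fin t → ℕ) :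
    {p : Ptn | (∑ᶠ m : ℕ, p.parts (m * t)) = n ∧
        ∀ i : Fin t,
          (∑ᶠ k : ℕ, (p.parts (k * t + (i : ℕ)) - p.parts (k * t + (i : ℕ) + 1))) = a i}.ncard
      = {μ : Fin t → Ptn | (∀ i, (μ i).length = a i) ∧ (∑ i, (μ i).size) = n}.ncard := by
  have : NeZero t := ⟨by omega⟩
  rw [← Nat.card_coe_set_eq, ← Nat.card_coe_set_eq]
  refine Nat.card_congr ((Ptn.colorEquiv t).subtypeEquiv fun p => ?_)
  simp only [Set.mem_ofPred_eq, Ptn.colorEquiv_length, Ptn.sum_colorEquiv_size]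
  exact and_comm
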